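/- Let (G,p_0) be a generic framework on a family of concentric cylinders Y and let (ω,λ) be an equilibrium stress for (G,p_0) on Y. Let (G,q_0) be a framework on Y which is equivalent to (G,p_0). Then there exists λ' : V → ℝ such that (ω,λ') is an equilibrium stress for (G,q_0) on Y. -/

import Mathlib

open Finset

/-- The `n×n` matrix `Ω(ω)` with off-diagonal entries `-ω i j` and diagonal entries `∑ k, ω i k`. -/
def omegaMat {n : ℕ} (ω : Fin n → Fin n → ℝ) : Matrix (Fin n) (Fin n) ℝ :=
  fun i j => if i = j then ∑ k, ω i k else -ω i j

/-- The `3n×3n` stress matrix `Ω_Y(ω,λ) = diag(Ω+Λ, Ω+Λ, Ω)` on a family of concentric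
cylinders, indexed by `Fin 3 × Fin n` (coordinate block × vertex). -/
def stressMatY {n : ℕ} (ω : Fin n → Fin n → ℝ) (lam : Fin n → ℝ) :
    Matrix (Fin 3 × Fin n) (Fin 3 × Fin n) ℝ :=
  fun r c => if r.1 = c.1 then
      omegaMat ω r.2 c.2 + (if r.2 = c.2 ∧ r.1 ≠ 2 then lam r.2 else 0)
    else 0

/-- `(ω,λ)` is an equilibrium stress for `(G,p)` on the family of concentric cylinders:
`∑_j ω_ij (p_i − p_j) + λ_i (x_i, y_i, 0) = 0` for all `i`. -/
def IsEquilStressY {n : ℕ} (p : Fin n → Fin 3 → ℝ)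
    (ω : Fin n → Fin n → ℝ) (lam : Fin n → ℝ) : Prop :=
  ∀ i, ∀ a : Fin 3,
    (∑ j, ω i j * (p i a - p j a)) + lam i * (if a = 2 then 0 else p i a) = 0

/-- `(ω,λ)` is a stress for the graph `G`: `ω` is symmetric and supported on the edges. -/
def IsStress {n : ℕ} (G : SimpleGraph (Fin n)) (ω : Fin n → Fin n → ℝ) : Prop :=
  (∀ i j, ω i j = ω j i) ∧ (∀ i j, ¬ G.Adj i j → ω i j = 0)

/-- The `6 × 3n` configuration matrix `C_Y(G,p)` for a framework on a family of
concentric cylinders, with rows `(x|0|0), (0|y|0), (0|0|z), (y|0|0), (0|x|0), (0|0|1)`. -/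
def configMatY {n : ℕ} (p : Fin n → Fin 3 → ℝ) : Matrix (Fin 6) (Fin 3 × Fin n) ℝ :=
  Matrix.of ![
    fun c => if c.1 = 0 then p c.2 0 else 0,
    fun c => if c.1 = 1 then p c.2 1 else 0,
    fun c => if c.1 = 2 then p c.2 2 else 0,
    fun c => if c.1 = 0 then p c.2 1 else 0,
    fun c => if c.1 = 1 then p c.2 0 else 0,
    fun c => if c.1 = 2 then 1 else 0]

/-- The configuration `p` is generic on the family of concentric cylinders with
radii-squares `r`: the transcendence degree of `ℚ(r,p)` over `ℚ(r)` equals `2n`, expressed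
by the existence of a transcendence basis of size `2n` among the coordinates of `p`. -/
def IsGenericConf (n : ℕ) (r : Fin n → ℝ) (p : Fin n → Fin 3 → ℝ) : Prop :=
  ∃ T : Finset ℝ,
    (↑T : Set ℝ) ⊆ Set.range (fun c : Fin n × Fin 3 => p c.1 c.2) ∧
    T.card = 2 * n ∧
    AlgebraicIndependent (IntermediateField.adjoin ℚ (Set.range r)) ((↑) : T → ℝ) ∧
    ∀ (i : Fin n) (a : Fin 3), IsAlgebraic
      (IntermediateField.adjoin (IntermediateField.adjoin ℚ (Set.range r)) (↑T : Set ℝ))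
      (p i a)

theorem algebraicIndependent_of_card_le {k E ι : Type*} [Field k] [Field E] [Algebra k E]
    [Fintype ι] (u : ι → E) (T : Finset E) (hT : AlgebraicIndependent k ((↑) : T → E))
    (hcard : Fintype.card ι ≤ T.card)
    (halg : ∀ t ∈ T, IsAlgebraic (Algebra.adjoin k (Set.range u)) t) :
    AlgebraicIndependent k u := by
  classical
  let M := AlgebraicIndependent.matroid k E
  have hTM : M.Indep (T : Set E) := hT
  have hsub : (T : Set E) ⊆ M.closure (Set.range u) := by
    rw [AlgebraicIndependent.matroid_closure_eq]
    exact halg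
  have hrk : (T.card : ℕ∞) ≤ M.eRk (Set.range u) := by
    rw [← M.eRk_closure_eq, ← Set.encard_coe_eq_coe_finsetCard]
    exact hTM.encard_le_eRk_of_subset hsub
  have hrange : Set.range u = (Finset.univ.image u : Finset E) := by simp
  have hle : (T.card : ℕ∞) ≤ (Finset.univ.image u).card := by
    rw [← Set.encard_coe_eq_coe_finsetCard (Finset.univ.image u), ← hrange]
    exact hrk.trans (M.eRk_le_encard _)
  have hle' : T.card ≤ (Finset.univ.image u).card := by exact_mod_cast hle
  have hinj : Function.Injective u := by
    rw [← Set.injOn_univ, ← Finset.coe_univ, ← Finset.card_image_iff]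
    exact le_antisymm Finset.card_image_le (hcard.trans hle')
  have hind : M.Indep (Set.range u) := by
    rw [Matroid.indep_iff_eRk_eq_encard_of_finite (Set.finite_range u)]
    refine le_antisymm (M.eRk_le_encard _) (le_trans ?_ hrk)
    rw [hrange, Set.encard_coe_eq_coe_finsetCard]
    exact_mod_cast (Finset.card_image_le.trans hcard)
  exact (algebraicIndependent_subtype_range hinj).1 hind

theorem formallySmooth_of_field_charZero {F L : Type*} [Field F] [CharZero F] [Field L]
    [Algebra F L] : Algebra.FormallySmooth F L := by
  obtain ⟨s, hs⟩ := exists_isTranscendenceBasis F L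
  have := hs.isAlgebraic_field
  exact .of_algebraicIndependent_of_isSeparable hs.1

theorem formallySmooth_subalgebra {k L : Type*} [Field k] [CharZero k] [Field L] [Algebra k L]
    (S : Subalgebra k L) : Algebra.FormallySmooth S L := by
  let := FractionRing.liftAlgebra S L
  have : Algebra.FormallySmooth S (FractionRing S) := .of_isLocalization (nonZeroDivisors S)
  have : CharZero (FractionRing S) := charZero_of_injective_algebraMap (algebraMap k _).injective
  have : Algebra.FormallySmooth (FractionRing S) L := formallySmooth_of_field_charZero
  exact .comp S (FractionRing S) L

theorem exists_lift_of_formallySmooth {S L B : Type*} [CommRing S] [CommRing L] [CommRing B]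
    [Algebra S L] [Algebra.FormallySmooth S L] (g : B →+* L) (hg : Function.Surjective g)
    (hn : IsNilpotent (RingHom.ker g)) (χ : S →+* B) (hχ : ∀ s, g (χ s) = algebraMap S L s) :
    ∃ Ψ : L →+* B, (∀ x, g (Ψ x) = x) ∧ ∀ s, Ψ (algebraMap S L s) = χ s := by
  let := χ.toAlgebra
  let g' : B →ₐ[S] L := { g with commutes' := hχ }
  let Ψ := Algebra.FormallySmooth.liftOfSurjective (AlgHom.id S L) g' hg hn
  exact ⟨Ψ, Algebra.FormallySmooth.liftOfSurjective_apply (AlgHom.id S L) g' hg hn, Ψ.commutes⟩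

open TrivSqZeroExt in
theorem exists_derivation_of_forall_aeval {k L ι : Type*} [Field k] [CharZero k] [Field L]
    [Algebra k L] (ℓ m : ι → L)
    (h : ∀ P : MvPolynomial ι k, MvPolynomial.aeval ℓ P = 0 →
      MvPolynomial.aeval (fun e => (inl (ℓ e) + inr (m e) : DualNumber L)) P = 0) :
    ∃ D : Derivation k L L, ∀ e, D (ℓ e) = m e := by
  let f : MvPolynomial ι k →ₐ[k] L := MvPolynomial.aeval ℓ
  let f' : MvPolynomial ι k →ₐ[k] DualNumber L :=
    MvPolynomial.aeval (fun e => (inl (ℓ e) + inr (m e) : DualNumber L))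
  have hff' : (fstHom k L L).comp f' = f := by
    ext e; simp [f, f']
  have := formallySmooth_subalgebra f.range
  have hs : Function.Surjective f.rangeRestrict := f.rangeRestrict_surjective
  have hker : RingHom.ker f.rangeRestrict.toRingHom ≤ RingHom.ker f'.toRingHom := by
    intro P hP
    exact h P (congrArg Subtype.val hP)
  let χ : f.range →+* DualNumber L :=
    (f.rangeRestrict.toRingHom.liftOfSurjective hs) ⟨f'.toRingHom, hker⟩
  have hχ : ∀ P, χ (f.rangeRestrict P) = f' P := fun P =>
    RingHom.liftOfRightInverse_comp_apply _ _ _ _ P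
  obtain ⟨Ψ, h1, h2⟩ := exists_lift_of_formallySmooth (S := f.range)
    (fstHom k L L).toRingHom (fun x => ⟨inl x, rfl⟩) ⟨2, by
      rw [Ideal.zero_eq_bot, eq_bot_iff, pow_two, Ideal.mul_le]
      intro x hx y hy
      have hx' : x.fst = 0 := hx
      have hy' : y.fst = 0 := hy
      rw [Ideal.mem_bot]
      ext <;> simp [hx', hy']⟩ χ (by
      intro s
      obtain ⟨P, rfl⟩ := hs s
      rw [hχ]
      exact DFunLike.congr_fun hff' P)
  have hfst : ∀ x, (Ψ x).fst = x := h1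
  have hP : ∀ P, Ψ (f P) = f' P := fun P => (h2 (f.rangeRestrict P)).trans (hχ P)
  have hc : ∀ c : k, Ψ (algebraMap k L c) = algebraMap k _ c := fun c => by
    simpa using hP (MvPolynomial.C c)
  refine ⟨Derivation.mk' { toFun := fun x => (Ψ x).snd, map_add' := by simp, map_smul' := ?_ } ?_,
    fun e => ?_⟩
  · intro c x
    simp [Algebra.smul_def, hc, algebraMap_eq_inl']
  · intro x y
    simp [hfst, mul_comm]
  · have := hP (MvPolynomial.X e)
    simp only [f, f', MvPolynomial.aeval_X] at this
    simp [this]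

/-- The relations saying that `(X i 0, X i 1, X i 2)` is the point of the cylinder of radius `σ i`
with rational parameter `u (inl i)` and height `u (inr i)`. -/
def IsCylinderParam {V k R : Type*} [CommRing k] [CommRing R] [Algebra k R] (σ : V → k)
    (u : V ⊕ V → R) (X : V → Fin 3 → R) : Prop :=
  ∀ i, X i 0 * (1 + u (.inl i) ^ 2) = algebraMap k R (σ i) * (1 - u (.inl i) ^ 2) ∧
    X i 1 * (1 + u (.inl i) ^ 2) = algebraMap k R (σ i) * (2 * u (.inl i)) ∧ X i 2 = u (.inr i)

open MvPolynomial in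
theorem exists_numerator_of_cylinderParam {V k : Type*} [Fintype V] [CommRing k] (σ : V → k)
    (P : MvPolynomial (V × Fin 3) k) :
    ∃ (N : ℕ) (Q : MvPolynomial (V ⊕ V) k), ∀ {R : Type} [CommRing R] [Algebra k R]
      (u : V ⊕ V → R) (X : V → Fin 3 → R), IsCylinderParam σ u X →
      aeval u Q = aeval (fun c : V × Fin 3 => X c.1 c.2) P *
        (∏ i, (1 + u (.inl i) ^ 2)) ^ N := by
  classical
  let D : MvPolynomial (V ⊕ V) k := ∏ i, (1 + X (.inl i) ^ 2)
  induction P using MvPolynomial.induction_on with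
  | C a => exact ⟨0, C a, fun u X _ => by simp⟩
  | add P₁ P₂ h₁ h₂ =>
    obtain ⟨N₁, Q₁, h₁⟩ := h₁
    obtain ⟨N₂, Q₂, h₂⟩ := h₂
    refine ⟨N₁ + N₂, Q₁ * D ^ N₂ + Q₂ * D ^ N₁, fun u X hX => ?_⟩
    simp only [map_add, map_mul, map_pow, h₁ u X hX, h₂ u X hX, D, map_prod, aeval_X, map_one]
    ring
  | mul_X P c h =>
    obtain ⟨N, Q, h⟩ := h
    obtain ⟨i, a⟩ := c
    have hprod : ∀ {R : Type} [CommRing R] (u : V ⊕ V → R),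
        ∏ j, (1 + u (.inl j) ^ 2) =
          (1 + u (.inl i) ^ 2) * ∏ j ∈ univ.erase i, (1 + u (.inl j) ^ 2) :=
      fun u => (mul_prod_erase _ _ (mem_univ i)).symm
    fin_cases a
    · refine ⟨N + 1, Q * (C (σ i) * (1 - X (.inl i) ^ 2) * ∏ j ∈ univ.erase i,
        (1 + X (.inl j) ^ 2)), fun u X hX => ?_⟩
      simp only [map_add, map_sub, map_mul, map_pow, h u X hX, map_prod, aeval_X, map_one, aeval_C,
        Fin.zero_eta, pow_succ _ N, ← (hX i).1]
      rw [hprod u]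
      ring
    · refine ⟨N + 1, Q * (C (σ i) * (2 * X (.inl i)) * ∏ j ∈ univ.erase i,
        (1 + X (.inl j) ^ 2)), fun u X hX => ?_⟩
      simp only [map_add, map_mul, map_pow, h u X hX, map_prod, aeval_X, map_one, aeval_C,
        Fin.mk_one, pow_succ _ N, map_ofNat, ← (hX i).2.1]
      rw [hprod u]
      ring
    · refine ⟨N, Q * X (.inr i), fun u X hX => ?_⟩
      simp only [map_mul, h u X hX, aeval_X, Fin.reduceFinMk, (hX i).2.2]
      ring

theorem isCylinderParam_of_sq_add_sq {V k R : Type*} [CommRing k] [CommRing R] [Algebra k R]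
    {σ : V → k} {X : V → Fin 3 → R} {u : V ⊕ V → R}
    (hX : ∀ i, X i 0 ^ 2 + X i 1 ^ 2 = algebraMap k R (σ i) ^ 2)
    (hunit : ∀ i, IsUnit (algebraMap k R (σ i) + X i 0))
    (hu : ∀ i, u (.inl i) * (algebraMap k R (σ i) + X i 0) = X i 1)
    (hu' : ∀ i, u (.inr i) = X i 2) : IsCylinderParam σ u X := by
  intro i
  have h := hX i
  rw [← hu i] at h ⊢
  set s := algebraMap k R (σ i)
  set t := u (.inl i)
  set x := X i 0
  have hx : x * (1 + t ^ 2) = s * (1 - t ^ 2) := by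
    apply (hunit i).mul_right_cancel
    linear_combination h
  refine ⟨hx, ?_, (hu' i).symm⟩
  linear_combination t * hx

theorem isUnit_one_add_sq_of_mul_eq {k R : Type*} [Field k] [CharZero k] [CommRing R] [Algebra k R]
    {s : k} (hs : s ≠ 0) {x y t : R} (h : x ^ 2 + y ^ 2 = algebraMap k R s ^ 2)
    (hunit : IsUnit (algebraMap k R s + x)) (ht : t * (algebraMap k R s + x) = y) :
    IsUnit (1 + t ^ 2) := by
  have h2 : IsUnit (algebraMap k R (2 * s)) := (IsUnit.mk0 _ (by simpa using hs)).map _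
  refine isUnit_of_mul_isUnit_left (y := algebraMap k R s + x) ?_
  convert h2 using 1
  apply hunit.mul_right_cancel
  simp only [map_mul, map_ofNat]
  subst ht
  linear_combination h

/-- Polynomial relations over `k` satisfied by a point on the cylinders with algebraically
independent parameters hold at every point of the cylinders, over any `k`-algebra. -/
theorem aeval_eq_zero_of_cylinderParam {V k : Type*} [Fintype V] [Field k] [CharZero k]
    {K R : Type} [Field K] [Algebra k K] [CommRing R] [Algebra k R]
    {σ : V → k} (hσ : ∀ i, σ i ≠ 0) {p : V → Fin 3 → K} {u : V ⊕ V → K}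
    (hu : AlgebraicIndependent k u) (hp : IsCylinderParam σ u p)
    {P : MvPolynomial (V × Fin 3) k}
    (hP : MvPolynomial.aeval (fun c : V × Fin 3 => p c.1 c.2) P = 0)
    {X : V → Fin 3 → R} (hX : ∀ i, X i 0 ^ 2 + X i 1 ^ 2 = algebraMap k R (σ i) ^ 2)
    (hunit : ∀ i, IsUnit (algebraMap k R (σ i) + X i 0)) :
    MvPolynomial.aeval (fun c : V × Fin 3 => X c.1 c.2) P = 0 := by
  obtain ⟨N, Q, hQ⟩ := exists_numerator_of_cylinderParam σ P
  have hQ0 : Q = 0 := by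
    apply (injective_iff_map_eq_zero _).1 hu
    rw [hQ u p hp, hP, zero_mul]
  choose t ht using fun i => (hunit i).dvd (a := X i 1)
  let w : V ⊕ V → R := Sum.elim t fun i => X i 2
  have hw : ∀ i, w (.inl i) * (algebraMap k R (σ i) + X i 0) = X i 1 := fun i => by
    rw [ht i, mul_comm]; rfl
  have := hQ w X (isCylinderParam_of_sq_add_sq hX hunit hw fun _ => rfl)
  rw [hQ0, map_zero] at this
  refine (IsUnit.mul_left_eq_zero (IsUnit.pow N ?_)).1 this.symm
  rw [IsUnit.prod_univ_iff]
  exact fun i => isUnit_one_add_sq_of_mul_eq (hσ i) (hX i) (hunit i) (hw i)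

open TrivSqZeroExt in
/-- Tangent vectors to the cylinders at `q` transport to derivations at `p`, compatibly with
polynomial functions taking the same value at `p` and `q`. -/
theorem exists_derivation_of_tangent {V k ι : Type*} [Fintype V] [Field k] [CharZero k]
    {K : Type} [Field K] [Algebra k K]
    {σ : V → k} (hσ : ∀ i, σ i ≠ 0) {p q v : V → Fin 3 → K} {u : V ⊕ V → K}
    (hu : AlgebraicIndependent k u) (hp : IsCylinderParam σ u p)
    (hq : ∀ i, q i 0 ^ 2 + q i 1 ^ 2 = algebraMap k K (σ i) ^ 2)
    (hq' : ∀ i, algebraMap k K (σ i) + q i 0 ≠ 0)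
    (hv : ∀ i, q i 0 * v i 0 + q i 1 * v i 1 = 0)
    (f : ι → MvPolynomial (V × Fin 3) k)
    (hf : ∀ e, MvPolynomial.aeval (fun c : V × Fin 3 => p c.1 c.2) (f e) =
      MvPolynomial.aeval (fun c : V × Fin 3 => q c.1 c.2) (f e)) :
    ∃ D : Derivation k K K, ∀ e, D (MvPolynomial.aeval (fun c : V × Fin 3 => p c.1 c.2) (f e)) =
      (MvPolynomial.aeval (fun c : V × Fin 3 =>
        (inl (q c.1 c.2) + inr (v c.1 c.2) : DualNumber K)) (f e)).snd := by
  let X : V → Fin 3 → DualNumber K := fun i a => inl (q i a) + inr (v i a)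
  refine exists_derivation_of_forall_aeval _ _ fun P hP => ?_
  rw [← MvPolynomial.aeval_bind₁] at hP
  have h := aeval_eq_zero_of_cylinderParam (X := X) hσ hu hp hP
    (fun i => by
      ext
      · simpa [X, algebraMap_eq_inl'] using hq i
      · simp [X, pow_two, algebraMap_eq_inl']
        linear_combination 2 * hv i)
    (fun i => by
      rw [isUnit_iff_isUnit_fst]
      simpa [X, algebraMap_eq_inl'] using hq' i)
  rw [MvPolynomial.aeval_bind₁] at h
  rw [← h]
  congr 2
  ext e
  · have : (fstHom k K K).comp (MvPolynomial.aeval fun c : V × Fin 3 => X c.1 c.2) =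
        MvPolynomial.aeval fun c : V × Fin 3 => q c.1 c.2 := by
      ext c; simp [X]
    simp only [fst_add, fst_inl, fst_inr, add_zero, hf e, ← this]
    rfl
  · simp [X]

theorem sum_sum_mul_sub_mul_sub {V K : Type*} [Fintype V] [CommRing K] {ω : V → V → K}
    (hω : ∀ i j, ω i j = ω j i) (x d : V → K) :
    ∑ i, ∑ j, ω i j * ((x i - x j) * (d i - d j)) =
      2 * ∑ i, d i * ∑ j, ω i j * (x i - x j) := by
  have h : ∑ i, ∑ j, ω i j * (x i - x j) * d j = -∑ i, ∑ j, ω i j * (x i - x j) * d i := by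
    rw [sum_comm, ← sum_neg_distrib]
    refine sum_congr rfl fun i _ => ?_
    rw [← sum_neg_distrib]
    refine sum_congr rfl fun j _ => ?_
    rw [hω j i]; ring
  have h' : ∀ i, d i * ∑ j, ω i j * (x i - x j) = ∑ j, ω i j * (x i - x j) * d i := fun i => by
    rw [mul_comm, sum_mul]
  calc _ = ∑ i, ∑ j, ω i j * (x i - x j) * d i - ∑ i, ∑ j, ω i j * (x i - x j) * d j := by
        simp only [← sum_sub_distrib]
        exact sum_congr rfl fun i _ => sum_congr rfl fun j _ => by ring
    _ = _ := by rw [h]; simp only [h']; ring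

/-- The coordinates of a point of a cylinder are algebraic over its rational parameter. -/
theorem isAlgebraic_of_cylinder {k E : Type*} [Field k] [CharZero k] [Field E] [Algebra k E]
    {s : k} (hs : s ≠ 0) {x y : E} (h : x ^ 2 + y ^ 2 = algebraMap k E s ^ 2)
    {S : Set E} (hS : y / (algebraMap k E s + x) ∈ S) :
    IsAlgebraic (Algebra.adjoin k S) x ∧ IsAlgebraic (Algebra.adjoin k S) y := by
  have hk : ∀ c : k, algebraMap k E c ∈ IntermediateField.adjoin k S := fun c =>
    IntermediateField.algebraMap_mem _ c
  suffices x ∈ IntermediateField.adjoin k S ∧ y ∈ IntermediateField.adjoin k S by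
    exact ⟨IntermediateField.isAlgebraic_adjoin_iff.1 (isAlgebraic_algebraMap (⟨x, this.1⟩ :
      IntermediateField.adjoin k S)), IntermediateField.isAlgebraic_adjoin_iff.1
      (isAlgebraic_algebraMap (⟨y, this.2⟩ : IntermediateField.adjoin k S))⟩
  set F := IntermediateField.adjoin k S
  set t := y / (algebraMap k E s + x) with ht
  have htF : t ∈ F := IntermediateField.subset_adjoin k S hS
  by_cases hx : algebraMap k E s + x = 0
  · have hx' : x = algebraMap k E (-s) := by rw [map_neg]; linear_combination hx
    have hy : y = 0 := by
      rw [hx', map_neg] at h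
      exact pow_eq_zero_iff two_ne_zero |>.1 (by linear_combination h)
    exact ⟨hx' ▸ hk _, hy ▸ F.zero_mem⟩
  · have hyt : t * (algebraMap k E s + x) = y := div_mul_cancel₀ _ hx
    have hu := (isUnit_one_add_sq_of_mul_eq hs h (IsUnit.mk0 _ hx) hyt).ne_zero
    have hxt : x = algebraMap k E s * (1 - t ^ 2) / (1 + t ^ 2) := by
      rw [eq_div_iff hu]
      apply mul_right_cancel₀ hx
      rw [← hyt] at h
      linear_combination h
    have hxF : x ∈ F := by
      rw [hxt]
      exact F.div_mem (F.mul_mem (hk s) (F.sub_mem F.one_mem (pow_mem htF 2)))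
        (F.add_mem F.one_mem (pow_mem htF 2))
    exact ⟨hxF, hyt ▸ F.mul_mem htF (F.add_mem (hk s) hxF)⟩

/-- A framework on the cylinders of full transcendence degree has algebraically independent
rational parameters. -/
theorem exists_algebraicIndependent_cylinderParam {V k E : Type*} [Fintype V] [Field k]
    [CharZero k] [Field E] [Algebra k E] {σ : V → k} (hσ : ∀ i, σ i ≠ 0) {p : V → Fin 3 → E}
    (hp : ∀ i, p i 0 ^ 2 + p i 1 ^ 2 = algebraMap k E (σ i) ^ 2) (T : Finset E)
    (hTp : (T : Set E) ⊆ Set.range fun c : V × Fin 3 => p c.1 c.2)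
    (hcard : T.card = 2 * Fintype.card V) (hT : AlgebraicIndependent k ((↑) : T → E)) :
    ∃ u : V ⊕ V → E, AlgebraicIndependent k u ∧ IsCylinderParam σ u p := by
  let u : V ⊕ V → E :=
    Sum.elim (fun i => p i 1 / (algebraMap k E (σ i) + p i 0)) fun i => p i 2
  have hmem : ∀ c, u c ∈ Set.range u := Set.mem_range_self
  have hu : AlgebraicIndependent k u := by
    refine algebraicIndependent_of_card_le u T hT (by simp [hcard, two_mul]) fun t ht => ?_
    obtain ⟨⟨i, a⟩, rfl⟩ := hTp ht
    have h := isAlgebraic_of_cylinder (hσ i) (hp i) (hmem (.inl i))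
    fin_cases a
    · exact h.1
    · exact h.2
    · exact isAlgebraic_algebraMap
        (⟨p i 2, Algebra.subset_adjoin (hmem (.inr i))⟩ : Algebra.adjoin k (Set.range u))
  have hne : ∀ i, algebraMap k E (σ i) + p i 0 ≠ 0 := fun i h =>
    hu.ne_zero (.inl i) (by simp [u, h])
  exact ⟨u, hu, isCylinderParam_of_sq_add_sq hp (fun i => IsUnit.mk0 _ (hne i))
    (fun i => div_mul_cancel₀ _ (hne i)) fun _ => rfl⟩

theorem sum_sum_mul_sum_sub_mul_sub {V A K : Type*} [Fintype V] [Fintype A] [CommRing K]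
    {ω : V → V → K} (hω : ∀ i j, ω i j = ω j i) (x d : V → A → K) :
    ∑ i, ∑ j, ω i j * ∑ a, 2 * ((x i a - x j a) * (d i a - d j a)) =
      4 * ∑ a, ∑ i, d i a * ∑ j, ω i j * (x i a - x j a) := by
  calc _ = ∑ a, ∑ i, ∑ j, 2 * (ω i j * ((x i a - x j a) * (d i a - d j a))) := by
        rw [Finset.sum_comm (s := (Finset.univ : Finset A))]
        simp only [Finset.mul_sum]
        refine Finset.sum_congr rfl fun i _ => ?_
        rw [Finset.sum_comm]
        exact Finset.sum_congr rfl fun a _ => Finset.sum_congr rfl fun j _ => by ring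
    _ = _ := by
        simp only [← Finset.mul_sum]
        rw [Finset.mul_sum, Finset.mul_sum]
        refine Finset.sum_congr rfl fun a _ => ?_
        rw [sum_sum_mul_sub_mul_sub hω (fun i => x i a) fun i => d i a]
        ring

/-- A stress annihilating the velocities of the squared edge lengths along all tangent vectors of
the cylinders is an equilibrium stress. -/
theorem exists_isEquilStressY_of_forall_tangent {n : ℕ} {r : Fin n → ℝ} (hr : ∀ i, 0 < r i)
    {q : Fin n → Fin 3 → ℝ} (hq : ∀ i, q i 0 ^ 2 + q i 1 ^ 2 = r i) {ω : Fin n → Fin n → ℝ}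
    (h : ∀ v : Fin n → Fin 3 → ℝ, (∀ i, q i 0 * v i 0 + q i 1 * v i 1 = 0) →
      ∑ a, ∑ i, v i a * ∑ j, ω i j * (q i a - q j a) = 0) :
    ∃ lam' : Fin n → ℝ, IsEquilStressY q ω lam' := by
  let S : Fin n → Fin 3 → ℝ := fun i a => ∑ j, ω i j * (q i a - q j a)
  have h' : ∀ i (w : Fin 3 → ℝ), q i 0 * w 0 + q i 1 * w 1 = 0 →
      w 0 * S i 0 + w 1 * S i 1 + w 2 * S i 2 = 0 := by
    intro i w hw
    have := h (Pi.single i w) (fun j => by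
      rcases eq_or_ne j i with rfl | hj
      · simpa using hw
      · simp [hj])
    have hs : ∀ a, ∑ j, (Pi.single i w : Fin n → Fin 3 → ℝ) j a * S j a = w a * S i a := fun a => by
      rw [Finset.sum_eq_single i] <;> simp +contextual
    change ∑ a, ∑ j, (Pi.single i w : Fin n → Fin 3 → ℝ) j a * S j a = 0 at this
    simpa only [hs, Fin.sum_univ_three] using this
  refine ⟨fun i => -(q i 0 * S i 0 + q i 1 * S i 1) / r i, fun i a => ?_⟩
  have hri := (hr i).ne'
  have h01 : -q i 1 * S i 0 + q i 0 * S i 1 = 0 := by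
    simpa using h' i ![-q i 1, q i 0, 0] (by simp; ring)
  have h2 : S i 2 = 0 := by simpa using h' i ![0, 0, 1] (by simp)
  change S i a + _ = 0
  fin_cases a
  · simp
    field_simp
    rw [← hq i]
    linear_combination -q i 1 * h01
  · simp
    field_simp
    rw [← hq i]
    linear_combination q i 0 * h01
  · simpa using h2

/-- An equilibrium stress annihilates the derivatives of the squared edge lengths. -/
theorem sum_mul_derivation_eq_zero {n : ℕ} {k : Type*} [Field k] [Algebra k ℝ]
    {p : Fin n → Fin 3 → ℝ} {ω : Fin n → Fin n → ℝ} {lam : Fin n → ℝ}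
    (hω : ∀ i j, ω i j = ω j i) (hequil : IsEquilStressY p ω lam)
    {σ : Fin n → k} (hp : ∀ i, p i 0 ^ 2 + p i 1 ^ 2 = algebraMap k ℝ (σ i) ^ 2)
    (D : Derivation k ℝ ℝ) :
    ∑ i, ∑ j, ω i j * D (∑ a, (p i a - p j a) ^ 2) = 0 := by
  have hD : ∀ i j, D (∑ a, (p i a - p j a) ^ 2) =
      ∑ a, 2 * ((p i a - p j a) * (D (p i a) - D (p j a))) := fun i j => by
    simp [Derivation.leibniz_pow]
  have hS : ∀ i a, ∑ j, ω i j * (p i a - p j a) = -(lam i * (if a = 2 then 0 else p i a)) :=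
    fun i a => eq_neg_of_add_eq_zero_left (hequil i a)
  have ht : ∀ i, p i 0 * D (p i 0) + p i 1 * D (p i 1) = 0 := fun i => by
    have := congrArg D (hp i)
    rw [← map_pow, Derivation.map_algebraMap] at this
    simp [Derivation.leibniz_pow] at this
    linear_combination this / 2
  simp only [hD]
  rw [sum_sum_mul_sum_sub_mul_sub hω p fun i a => D (p i a)]
  simp only [hS, Fin.sum_univ_three, ← Finset.sum_add_distrib]
  rw [Finset.sum_eq_zero, mul_zero]
  intro i _
  simp
  linear_combination -lam i * ht i

theorem stmt19 (n : ℕ) (G : SimpleGraph (Fin n))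
    (r : Fin n → ℝ) (hr : ∀ i, 0 < r i)
    (p₀ q₀ : Fin n → Fin 3 → ℝ)
    (hp : ∀ i, (p₀ i 0) ^ 2 + (p₀ i 1) ^ 2 = r i)
    (hq : ∀ i, (q₀ i 0) ^ 2 + (q₀ i 1) ^ 2 = r i)
    (hgen : IsGenericConf n r p₀)
    (ω : Fin n → Fin n → ℝ) (lam : Fin n → ℝ) (hω : IsStress G ω)
    (hequil : IsEquilStressY p₀ ω lam)
    (hequiv : ∀ i j, G.Adj i j →
      ∑ a, (p₀ i a - p₀ j a) ^ 2 = ∑ a, (q₀ i a - q₀ j a) ^ 2) :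
    ∃ lam' : Fin n → ℝ, IsEquilStressY q₀ ω lam' := by
  obtain ⟨T, hTp, hcard, hT, -⟩ := hgen
  let k := algebraicClosure (IntermediateField.adjoin ℚ (Set.range r)) ℝ
  have hTk : AlgebraicIndependent k ((↑) : T → ℝ) := hT.algebraicClosure
  have hs : ∀ i, ∃ s : k, (s : ℝ) ^ 2 = r i ∧ (s : ℝ) + q₀ i 0 ≠ 0 := fun i => by
    have hsq : (√(r i)) ^ 2 = r i := Real.sq_sqrt (hr i).le
    have hpos := Real.sqrt_pos.2 (hr i)
    have hmem : √(r i) ∈ k := by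
      rw [mem_algebraicClosure_iff]
      refine IsAlgebraic.of_pow two_pos ?_
      rw [hsq]
      exact isAlgebraic_algebraMap (⟨r i, IntermediateField.subset_adjoin ℚ _ ⟨i, rfl⟩⟩ :
        IntermediateField.adjoin ℚ (Set.range r))
    rcases le_total 0 (q₀ i 0) with h | h
    · exact ⟨⟨_, hmem⟩, hsq, (by positivity : √(r i) + q₀ i 0 ≠ 0)⟩
    · exact ⟨⟨_, k.neg_mem hmem⟩, (neg_sq _).trans hsq,
        (by linarith : -√(r i) + q₀ i 0 < 0).ne⟩
  choose σ hσ hσq using hs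
  have hσ0 : ∀ i, σ i ≠ 0 := fun i h => (hr i).ne' (by rw [← hσ i, h]; simp)
  have hpσ : ∀ i, p₀ i 0 ^ 2 + p₀ i 1 ^ 2 = algebraMap k ℝ (σ i) ^ 2 := fun i =>
    (hp i).trans (hσ i).symm
  obtain ⟨u, hu, hup⟩ := exists_algebraicIndependent_cylinderParam hσ0 hpσ T hTp
    (by simpa using hcard) hTk
  refine exists_isEquilStressY_of_forall_tangent hr hq fun v hv => ?_
  let f : {e : Fin n × Fin n // G.Adj e.1 e.2} → MvPolynomial (Fin n × Fin 3) k := fun e =>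
    ∑ a, (MvPolynomial.X (e.1.1, a) - MvPolynomial.X (e.1.2, a)) ^ 2
  obtain ⟨D, hD⟩ := exists_derivation_of_tangent (q := q₀) hσ0 hu hup
    (fun i => (hq i).trans (hσ i).symm) hσq hv f fun e => by
      simpa [f] using hequiv _ _ e.2
  have hedge : ∀ i j, ω i j * D (∑ a, (p₀ i a - p₀ j a) ^ 2) =
      ω i j * ∑ a, 2 * ((q₀ i a - q₀ j a) * (v i a - v j a)) := fun i j => by
    by_cases hij : G.Adj i j
    · have := hD ⟨(i, j), hij⟩
      simp only [f, map_sum, map_pow, map_sub, MvPolynomial.aeval_X] at this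
      rw [map_sum, this]
      congr 1
      simp only [Fin.sum_univ_three, pow_two, TrivSqZeroExt.snd_add, TrivSqZeroExt.snd_mul,
        TrivSqZeroExt.fst_sub, TrivSqZeroExt.snd_sub, TrivSqZeroExt.fst_add,
        TrivSqZeroExt.fst_inl, TrivSqZeroExt.fst_inr, TrivSqZeroExt.snd_inl,
        TrivSqZeroExt.snd_inr, smul_eq_mul, MulOpposite.smul_eq_mul_unop, MulOpposite.unop_op]
      ring
    · rw [hω.2 i j hij, zero_mul, zero_mul]
  have h := sum_mul_derivation_eq_zero hω.1 hequil hpσ D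
  simp only [hedge] at h
  rw [sum_sum_mul_sum_sub_mul_sub hω.1] at h
  linarith
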